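/- (Modified Xiao Lemma) Let f̂: Ŝ → C be a fibred surface with general fiber F, let D̂ be a divisor on Ŝ, and suppose there exist effective divisors 𝓩₁ ≥ 𝓩₂ ≥ … ≥ 𝓩_j and rational numbers μ₁ ≥ μ₂ ≥ … ≥ μ_j such that for every i ∈ {1,…,j} the ℚ-divisor 𝓝_i := D̂ − 𝓩_i − μ_i F is nef. Then D̂² ≥ Σ_{i=1}^{j−1} (d_i + d_{i+1})(μ_i − μ_{i+1}) + 2 D̂·𝓩_j − 𝓩_j² + 2 μ_j d_j, where d_i = 𝓝_i · F. -/

import Mathlib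

/-!
Statement 8 (Lemma 4.1, the Modified Xiao Lemma).  `f̂ : Ŝ → C` is a fibred
surface (surjective morphism with connected fibers from a smooth complex
projective surface to a smooth complex projective curve) with general fiber `F`
(so `F² = 0`).  ℚ-divisor classes on `Ŝ` are modelled by a ℚ-vector space with
the intersection form `inter` and the predicates `Effective` and `Nef` (a
ℚ-divisor `N` is nef when `N · Γ ≥ 0` for every curve `Γ` on `Ŝ`; the fields
`nef_inter_effective` and `nef_self` record the standard consequences on a
projective surface). -/
structure SurfaceData where
  /-- ℚ-divisor classes on `Ŝ` -/
  Div : Type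
  [instAddCommGroup : AddCommGroup Div]
  [instModule : Module ℚ Div]
  /-- the intersection form -/
  inter : Div → Div → ℚ
  inter_symm : ∀ x y, inter x y = inter y x
  inter_add_left : ∀ x y z, inter (x + y) z = inter x z + inter y z
  inter_smul_left : ∀ (c : ℚ) (x y), inter (c • x) y = c * inter x y
  /-- effective (ℚ-)divisor classes -/
  Effective : Div → Prop
  /-- nef (ℚ-)divisor classes -/
  Nef : Div → Prop
  nef_inter_effective : ∀ {N Z}, Nef N → Effective Z → 0 ≤ inter N Z
  nef_self : ∀ {N}, Nef N → 0 ≤ inter N N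
  effective_add : ∀ {x y}, Effective x → Effective y → Effective (x + y)
  effective_smul : ∀ {c : ℚ} {x}, 0 ≤ c → Effective x → Effective (c • x)
  /-- the class of a general fiber `F` of `f̂` -/
  F : Div
  effective_F : Effective F
  inter_F_F : inter F F = 0

attribute [instance] SurfaceData.instAddCommGroup SurfaceData.instModule

namespace SurfaceData

variable (X : SurfaceData)

theorem inter_add_right (x y z : X.Div) : X.inter x (y + z) = X.inter x y + X.inter x z := by
  rw [X.inter_symm, X.inter_add_left, X.inter_symm y, X.inter_symm z]

theorem inter_smul_right (c : ℚ) (x y : X.Div) : X.inter x (c • y) = c * X.inter x y := by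
  rw [X.inter_symm, X.inter_smul_left, X.inter_symm y]

/-- If `N'` and `N` are nef and differ by an effective class plus `c • F`, then the growth of the
self-intersection is at least `c * (N + N') · F`. -/
theorem inter_self_add_le_of_nef {N N' E : X.Div} {c : ℚ} (hN : X.Nef N) (hN' : X.Nef N')
    (hE : X.Effective E) (h : N' = N + (E + c • X.F)) :
    X.inter N N + (X.inter N X.F + X.inter N' X.F) * c ≤ X.inter N' N' := by
  have hNE := X.nef_inter_effective hN hE
  have hNE' := X.nef_inter_effective hN' hE
  have h₁ : X.inter N' N' = X.inter N' N + (X.inter N' E + c * X.inter N' X.F) := by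
    conv_lhs => rw [h, X.inter_symm, ← h]
    rw [X.inter_symm, ← X.inter_smul_right, ← X.inter_add_right, ← X.inter_add_right, ← h]
  have h₂ : X.inter N' N = X.inter N N + (X.inter N E + c * X.inter N X.F) := by
    rw [X.inter_symm, h, X.inter_add_right, X.inter_add_right, X.inter_smul_right]
  linarith

end SurfaceData

/-- Modified Xiao Lemma, Lemma 4.1.  Let `D̂` be a divisor on
`Ŝ` and suppose there are effective divisors `𝓩₁ ≥ 𝓩₂ ≥ … ≥ 𝓩_j` and rational
numbers `μ₁ ≥ μ₂ ≥ … ≥ μ_j` such that the ℚ-divisors `𝓝_i = D̂ - 𝓩_i - μ_i F`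
are nef for `1 ≤ i ≤ j`.  Then, with `d_i = 𝓝_i · F`,
`D̂² ≥ Σ_{i=1}^{j-1} (d_i + d_{i+1})(μ_i - μ_{i+1}) + 2 D̂·𝓩_j - 𝓩_j² + 2 μ_j d_j`. -/
theorem statement8 (X : SurfaceData)
    (Dhat : X.Div) (j : ℕ) (hj : 1 ≤ j)
    (𝓩 : ℕ → X.Div) (μ : ℕ → ℚ)
    (𝓝 : ℕ → X.Div) (h𝓝 : ∀ i, 𝓝 i = Dhat - 𝓩 i - μ i • X.F)
    (d : ℕ → ℚ) (hd : ∀ i, d i = X.inter (𝓝 i) X.F)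
    (hZeff : ∀ i, 1 ≤ i → i ≤ j → X.Effective (𝓩 i))
    (hZanti : ∀ i, 1 ≤ i → i < j → X.Effective (𝓩 i - 𝓩 (i + 1)))
    (hμanti : ∀ i, 1 ≤ i → i < j → μ (i + 1) ≤ μ i)
    (hnef : ∀ i, 1 ≤ i → i ≤ j → X.Nef (𝓝 i)) :
    (∑ i ∈ Finset.Ico 1 j, (d i + d (i + 1)) * (μ i - μ (i + 1)))
        + 2 * X.inter Dhat (𝓩 j) - X.inter (𝓩 j) (𝓩 j) + 2 * μ j * d j
      ≤ X.inter Dhat Dhat := by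
  have chain : ∀ k, 1 ≤ k → k ≤ j →
      ∑ i ∈ Finset.Ico 1 k, (d i + d (i + 1)) * (μ i - μ (i + 1)) ≤ X.inter (𝓝 k) (𝓝 k) := by
    intro k hk
    induction k, hk using Nat.le_induction with
    | base =>
      intro h
      simpa using X.nef_self (hnef 1 le_rfl h)
    | succ k hk ih =>
      intro h
      have hstep : 𝓝 (k + 1) =
          𝓝 k + ((𝓩 k - 𝓩 (k + 1)) + (μ k - μ (k + 1)) • X.F) := by
        rw [h𝓝, h𝓝]
        module
      have := X.inter_self_add_le_of_nef (hnef k hk (by lia)) (hnef (k + 1) (by lia) h)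
        (hZanti k hk h) hstep
      rw [Finset.sum_Ico_succ_top hk, hd k, hd (k + 1)]
      linarith [ih (by lia)]
  have hsum := chain j hj le_rfl
  have hD : Dhat = 𝓝 j + μ j • X.F + 𝓩 j := by
    rw [h𝓝]
    module
  have hself : X.inter Dhat Dhat = X.inter (𝓝 j) (𝓝 j) + 2 * X.inter Dhat (𝓩 j)
      - X.inter (𝓩 j) (𝓩 j) + 2 * μ j * d j := by
    rw [hd, hD]
    simp only [X.inter_add_left, X.inter_add_right, X.inter_smul_left, X.inter_smul_right,
      X.inter_F_F, X.inter_symm X.F (𝓝 j), X.inter_symm (𝓩 j) (𝓝 j), X.inter_symm (𝓩 j) X.F]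
    ring
  linarith
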